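/- Let k ≥ 3 be an integer. Every non boolean facet defining inequality of Q(C_{3k}^k) with positive integer coefficients is of the form a^0·(2∑_{i∈W} x_i + ∑_{i∉W} x_i) ≥ 4a^0 for some integer a^0 ≥ 1 and some W ⊆ Z_{3k} satisfying |W ∩ x^j| = 1 and |C^j ∩ (Z_{3k} ∖ W)| ≥ 2 for every j ∈ Z_{3k}; that is, it is a minor inequality corresponding to a circulant minor defined by such a W. -/

import Mathlib

/-- `Cseg n k i` is the set `C^i = {i, i+1, …, i+k−1} ⊆ ℤ_n`. -/
def Cseg (n k : ℕ) (i : ZMod n) : Finset (ZMod n) :=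
  (Finset.range k).image fun h : ℕ => i + (h : ZMod n)

/-- A cover of the circulant matrix `C_n^k`. -/
def IsCover (n k : ℕ) (x : Finset (ZMod n)) : Prop :=
  ∀ i : ZMod n, (x ∩ Cseg n k i).Nonempty

/-- A minimal cover of `C_n^k`. -/
def IsMinimalCover (n k : ℕ) (x : Finset (ZMod n)) : Prop :=
  IsCover n k x ∧ ∀ y : Finset (ZMod n), y ⊂ x → ¬ IsCover n k y

/-- The covering number `τ(C_n^k)`. -/
noncomputable def coveringNumber (n k : ℕ) : ℕ :=
  sInf {m : ℕ | ∃ x : Finset (ZMod n), IsCover n k x ∧ x.card = m}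

/-- A minimum cover of `C_n^k`. -/
noncomputable def IsMinimumCover (n k : ℕ) (x : Finset (ZMod n)) : Prop :=
  IsCover n k x ∧ x.card = coveringNumber n k

/-- `xcov n k i` is the cover `x^i = {i + h·k : 0 ≤ h ≤ ⌈n/k⌉ − 1}`. -/
def xcov (n k : ℕ) (i : ZMod n) : Finset (ZMod n) :=
  (Finset.range ((n + k - 1) / k)).image fun h : ℕ => i + ((h * k : ℕ) : ZMod n)

/-- The cyclic closed interval `[a,b]_n` of `ℤ_n`. -/
def cycInterval (n : ℕ) (a b : ZMod n) : Finset (ZMod n) :=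
  (Finset.range ((b - a).val + 1)).image fun h : ℕ => a + (h : ZMod n)

/-- The inequality `a·x ≥ α` is valid for `Q(C_n^k)`. -/
def IsValid (n k : ℕ) (a : ZMod n → ℤ) (α : ℤ) : Prop :=
  ∀ x : Finset (ZMod n), IsCover n k x → α ≤ ∑ i ∈ x, a i

/-- A root of a valid inequality: a cover satisfying it with equality. -/
def IsRoot (n k : ℕ) (a : ZMod n → ℤ) (α : ℤ) (x : Finset (ZMod n)) : Prop :=
  IsCover n k x ∧ ∑ i ∈ x, a i = α

/-- Characteristic vector of a subset of `ℤ_n`. -/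
noncomputable def charVec (n : ℕ) (x : Finset (ZMod n)) : ZMod n → ℝ :=
  fun i => if i ∈ x then 1 else 0

/-- `a·x ≥ α` is facet defining for `Q(C_n^k)`: it is valid, and the characteristic
vectors of its roots affinely span an `(n−1)`-dimensional affine subspace of `ℝ^n`. -/
def IsFacet (n k : ℕ) (a : ZMod n → ℤ) (α : ℤ) : Prop :=
  IsValid n k a α ∧
    Module.finrank ℝ
      (affineSpan ℝ
        {v : ZMod n → ℝ | ∃ x : Finset (ZMod n), IsRoot n k a α x ∧ v = charVec n x}).direction
      = n - 1

/-- `a·x ≥ α` is a positive multiple of one of the boolean inequalities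
`x_i ≥ 0`, `−x_i ≥ −1`, `∑_{j ∈ C^i} x_j ≥ 1`. -/
def IsBooleanMultiple (n k : ℕ) (a : ZMod n → ℤ) (α : ℤ) : Prop :=
  ∃ c : ℤ, 0 < c ∧
    ( (∃ i : ZMod n, (∀ j, a j = if j = i then c else 0) ∧ α = 0)
    ∨ (∃ i : ZMod n, (∀ j, a j = if j = i then -c else 0) ∧ α = -c)
    ∨ (∃ i : ZMod n, (∀ j, a j = if j ∈ Cseg n k i then c else 0) ∧ α = c) )

/-- `a·x ≥ α` is a positive multiple of the rank constraint `∑ x_i ≥ ⌈n/k⌉`. -/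
def IsRankMultiple (n k : ℕ) (a : ZMod n → ℤ) (α : ℤ) : Prop :=
  ∃ c : ℤ, 0 < c ∧ (∀ j, a j = c) ∧ α = c * (((n + k - 1) / k : ℕ) : ℤ)

/-- A `ℤ`-indexed primitive of a function on `ℤ_n`: its increments are the values of `w`. -/
def IsPrimitive {n : ℕ} (w : ZMod n → ℤ) (W : ℤ → ℤ) : Prop :=
  ∀ p : ℤ, W (p + 1) = W p + w (p : ZMod n)

theorem exists_isPrimitive {n : ℕ} (w : ZMod n → ℤ) : ∃ W, IsPrimitive w W := by
  refine ⟨fun p => ∑ q ∈ Finset.range p.toNat, w ((q : ℤ) : ZMod n)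
    - ∑ q ∈ Finset.range (-p).toNat, w (((-1 - q : ℤ)) : ZMod n), fun p => ?_⟩
  rcases lt_or_ge p 0 with hp | hp
  · obtain ⟨m, rfl⟩ : ∃ m : ℕ, p = -1 - m := ⟨(-p - 1).toNat, by omega⟩
    have h1 : (-1 - (m : ℤ) + 1).toNat = 0 := by omega
    have h2 : (-(-1 - (m : ℤ) + 1)).toNat = m := by omega
    have h3 : (-1 - (m : ℤ)).toNat = 0 := by omega
    have h4 : (-(-1 - (m : ℤ))).toNat = m + 1 := by omega
    simp only [h1, h2, h3, h4, Finset.sum_range_succ]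
    ring
  · obtain ⟨m, rfl⟩ := Int.eq_ofNat_of_zero_le hp
    have h1 : ((m : ℤ) + 1).toNat = m + 1 := by omega
    have h2 : (-((m : ℤ) + 1)).toNat = 0 := by omega
    have h3 : (-(m : ℤ)).toNat = 0 := by omega
    simp only [h1, h2, h3, Int.toNat_natCast, Finset.sum_range_succ]
    ring

theorem IsPrimitive.sub_const {n : ℕ} {w : ZMod n → ℤ} {W : ℤ → ℤ} (hW : IsPrimitive w W)
    (τ : ℤ) : IsPrimitive w fun p => W p - τ := fun p => by
  have := hW p
  simp only; omega

theorem IsPrimitive.add_nat {n : ℕ} {w : ZMod n → ℤ} {W : ℤ → ℤ} (hW : IsPrimitive w W)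
    (p : ℤ) (m : ℕ) : W (p + m) = W p + ∑ h ∈ Finset.range m, w ((p : ZMod n) + h) := by
  induction m with
  | zero => simp
  | succ m ih =>
    rw [Finset.sum_range_succ, ← add_assoc, ← ih, Nat.cast_succ, ← add_assoc, hW]
    simp

theorem IsPrimitive.monotone {n : ℕ} {w : ZMod n → ℤ} {W : ℤ → ℤ} (hW : IsPrimitive w W)
    (hw : ∀ i, 0 ≤ w i) : Monotone W :=
  monotone_int_of_le_succ fun p => by rw [hW p]; linarith [hw p]

theorem Cseg_injOn {n k : ℕ} (hk : k ≤ n) (i : ZMod n) :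
    Set.InjOn (fun h : ℕ => i + (h : ZMod n)) (Finset.range k : Finset ℕ) := by
  intro x hx y hy hxy
  simp only [Finset.coe_range, Set.mem_Iio] at hx hy
  have h := (ZMod.natCast_eq_natCast_iff' x y n).1 (add_left_cancel hxy)
  rwa [Nat.mod_eq_of_lt (by omega), Nat.mod_eq_of_lt (by omega)] at h

theorem sum_Cseg {n k : ℕ} (hk : k ≤ n) (i : ZMod n) (w : ZMod n → ℤ) :
    ∑ l ∈ Cseg n k i, w l = ∑ h ∈ Finset.range k, w (i + h) :=
  Finset.sum_image (Cseg_injOn hk i)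

theorem card_Cseg {n k : ℕ} (hk : k ≤ n) (i : ZMod n) : (Cseg n k i).card = k := by
  rw [Cseg, Finset.card_image_of_injOn (Cseg_injOn hk i), Finset.card_range]

theorem Cseg_self {n : ℕ} [NeZero n] (i : ZMod n) : Cseg n n i = Finset.univ := by
  rw [← Finset.card_eq_iff_eq_univ, card_Cseg le_rfl, ZMod.card]

theorem IsPrimitive.sum_Cseg {n k : ℕ} (hk : k ≤ n) {w : ZMod n → ℤ} {W : ℤ → ℤ}
    (hW : IsPrimitive w W) (p : ℤ) :
    ∑ l ∈ Cseg n k (p : ZMod n), w l = W (p + k) - W p := by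
  rw [_root_.sum_Cseg hk, hW.add_nat]; ring

theorem IsPrimitive.add_period {n : ℕ} [NeZero n] {w : ZMod n → ℤ} {W : ℤ → ℤ}
    (hW : IsPrimitive w W) (p : ℤ) : W (p + n) = W p + ∑ l, w l := by
  have := hW.sum_Cseg le_rfl p
  rw [Cseg_self] at this
  linarith

theorem IsPrimitive.add_mul_period {n : ℕ} [NeZero n] {w : ZMod n → ℤ} {W : ℤ → ℤ}
    (hW : IsPrimitive w W) (p q : ℤ) : W (p + q * n) = W p + q * ∑ l, w l := by
  induction q using Int.induction_on with
  | zero => simp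
  | succ q ih =>
    rw [add_mul, one_mul, ← add_assoc, hW.add_period, ih]; ring
  | pred q ih =>
    have := hW.add_period (p + (-q - 1) * n)
    rw [show p + (-q - 1) * (n : ℤ) + n = p + -q * n by ring, ih] at this
    linarith

/-- Every residue has a lift at which a primitive takes a value in `(-T, 0]`, where `T` is the
total weight. -/
theorem IsPrimitive.exists_lift {n : ℕ} [NeZero n] {w : ZMod n → ℤ} {W : ℤ → ℤ}
    (hW : IsPrimitive w W) (hT : 0 < ∑ l, w l) (i : ZMod n) :
    ∃ p : ℤ, (p : ZMod n) = i ∧ -(∑ l, w l) < W p ∧ W p ≤ 0 := by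
  refine ⟨(i.val : ℤ) + (-W i.val / ∑ l, w l) * n, by simp, ?_⟩
  rw [hW.add_mul_period]
  have h1 := Int.emod_nonneg (-W i.val) hT.ne'
  have h2 := Int.emod_lt_of_pos (-W i.val) hT
  have h3 := Int.emod_add_mul_ediv (-W i.val) (∑ l, w l)
  constructor <;> linarith [mul_comm (∑ l, w l) (-W i.val / ∑ l, w l)]

/-- Selecting items, listed in cyclic order, according to a counting function `c`. -/
theorem IsPrimitive.exists_selection {n : ℕ} [NeZero n] {w : ZMod n → ℤ} {W : ℤ → ℤ}
    (hW : IsPrimitive w W) (hw : ∀ i, 0 ≤ w i) {c : ℤ → ℤ} {m : ℤ}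
    (hc : ∀ t, c t ≤ c (t + 1) ∧ c (t + 1) ≤ c t + 1)
    (hper : ∀ t, c (t + ∑ l, w l) = c t + m) :
    ∃ u : ZMod n → ℤ, (∀ i, 0 ≤ u i) ∧ (∀ i, u i ≤ w i) ∧ ∑ l, u l = m ∧
      IsPrimitive u (c ∘ W) := by
  have hlip : ∀ (t : ℤ) (s : ℕ), c t ≤ c (t + s) ∧ c (t + s) ≤ c t + s := by
    intro t s
    induction s with
    | zero => simp
    | succ s ih =>
      have := hc (t + s)
      push_cast
      rw [← add_assoc]
      constructor <;> linarith [ih.1, ih.2, this.1, this.2]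
  have hperq : ∀ t q : ℤ, c (t + q * ∑ l, w l) = c t + q * m := by
    intro t q
    induction q using Int.induction_on with
    | zero => simp
    | succ q ih => rw [add_mul, one_mul, ← add_assoc, hper, ih]; ring
    | pred q ih =>
      have := hper (t + (-q - 1) * ∑ l, w l)
      rw [show t + (-q - 1) * (∑ l, w l) + ∑ l, w l = t + -q * ∑ l, w l by ring, ih] at this
      linarith
  have hstep : ∀ p : ℤ, c (W p) ≤ c (W (p + 1)) ∧ c (W (p + 1)) ≤ c (W p) + w p := by
    intro p
    have := hlip (W p) (w p).toNat
    rwa [Int.toNat_of_nonneg (hw p), ← hW p] at this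
  have hu : IsPrimitive (fun i : ZMod n => c (W (i.val + 1)) - c (W i.val)) (c ∘ W) := by
    intro p
    have hp : ((p : ZMod n).val : ℤ) = p + (-(p / n)) * n := by
      rw [ZMod.val_intCast]
      have := Int.emod_add_mul_ediv p n
      linarith
    simp only [Function.comp_apply]
    rw [hp, add_right_comm, hW.add_mul_period, hW.add_mul_period, hperq, hperq]
    ring
  refine ⟨_, fun i => ?_, fun i => ?_, ?_, hu⟩
  · linarith [(hstep i.val).1]
  · have := (hstep i.val).2
    rw [Int.cast_natCast, ZMod.natCast_zmod_val] at this
    linarith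
  · have h1 := hu.add_period 0
    simp only [Function.comp_apply, hW.add_period, hper] at h1
    linarith

/-- Some interval of length `k + 1` carries more than a third of the total weight. -/
theorem IsPrimitive.exists_heavy {k : ℕ} [NeZero (3 * k)] {w : ZMod (3 * k) → ℤ} {W : ℤ → ℤ}
    (hW : IsPrimitive w W) (hw : ∀ i, 0 ≤ w i) (hT : 0 < ∑ l, w l) {M : ℤ}
    (hM : 3 * M ≤ ∑ l, w l) : ∃ p : ℤ, M + 1 ≤ W (p + k + 1) - W p := by
  obtain ⟨i, -, hi⟩ : ∃ i ∈ Finset.univ, 0 < w i := by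
    by_contra! h
    exact absurd (Finset.sum_nonpos h) (by linarith)
  by_contra! h
  have h0 := h i.val
  have h1 := h (i.val + k)
  have h2 := h (i.val + k + k)
  have h3 := hW.add_period i.val
  have hm := hW.monotone hw
  have h4 := hm (show (i.val : ℤ) + k ≤ i.val + k + 1 by omega)
  have h5 := hm (show (i.val : ℤ) + k + k ≤ i.val + k + k + 1 by omega)
  have h6 := hW (i.val + (3 * k : ℕ))
  have h7 : (((i.val : ℤ) + (3 * k : ℕ) : ℤ) : ZMod (3 * k)) = i := by
    rw [Int.cast_add, Int.cast_natCast, Int.cast_natCast, ZMod.natCast_self]; simp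
  rw [h7] at h6
  rw [show (i.val : ℤ) + (3 * k : ℕ) = i.val + k + k + k by push_cast; ring] at h3 h6
  omega

theorem exists_periodic_extension {c₀ : ℤ → ℤ} {T m : ℤ} (hT : 0 < T)
    (hc : ∀ t, 0 ≤ t → t < T → c₀ t ≤ c₀ (t + 1) ∧ c₀ (t + 1) ≤ c₀ t + 1)
    (hm : c₀ T = c₀ 0 + m) :
    ∃ c : ℤ → ℤ, (∀ t, c t ≤ c (t + 1) ∧ c (t + 1) ≤ c t + 1) ∧ (∀ t, c (t + T) = c t + m) ∧
      ∀ t, 0 ≤ t → t ≤ T → c t = c₀ t := by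
  let c : ℤ → ℤ := fun t => m * (t / T) + c₀ (t % T)
  have e : ∀ s q, c (s + T * q) = c s + m * q := by
    intro s q
    simp only [c, Int.add_mul_emod_self_left, Int.add_mul_ediv_left _ _ hT.ne']
    ring
  have hval : ∀ t, 0 ≤ t → t ≤ T → c t = c₀ t := by
    intro t h0 h1
    rcases h1.lt_or_eq with h1 | rfl
    · simp only [c, Int.emod_eq_of_lt h0 h1, Int.ediv_eq_zero_of_lt h0 h1]; ring
    · simp only [c, Int.emod_self, Int.ediv_self hT.ne', hm]; ring
  refine ⟨c, fun t => ?_, fun t => by simpa using e t 1, hval⟩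
  have h0 := Int.emod_nonneg t hT.ne'
  have h1 := Int.emod_lt_of_pos t hT
  have e1 := e (t % T) (t / T)
  have e2 := e (t % T + 1) (t / T)
  rw [add_right_comm, Int.emod_add_mul_ediv] at e2
  rw [Int.emod_add_mul_ediv] at e1
  rw [e1, e2, hval _ h0 h1.le, hval _ (by omega) (by omega)]
  have := hc _ h0 h1
  constructor <;> linarith [this.1, this.2]

/-- Counting function of the items `0, N, 2N, 3N` modulo `T`. -/
theorem exists_selection_four {N T : ℤ} (hN : 1 ≤ N) (hT : 4 * N ≤ T) :
    ∃ c : ℤ → ℤ, (∀ t, c t ≤ c (t + 1) ∧ c (t + 1) ≤ c t + 1) ∧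
      (∀ t, c (t + T) = c t + 4) ∧
      ∀ A B : ℤ, -T < A → A ≤ 0 → A + N ≤ B → B ≤ A + T → (B ≤ 0 → A ≤ 3 * N - T) →
        1 ≤ c B - c A ∧ c B - c A ≤ B - A - N + 1 := by
  obtain ⟨c, hstep, hper, hval⟩ := exists_periodic_extension (T := T) (m := 4)
    (c₀ := fun t => if t ≤ 0 then 0 else if t ≤ N then 1 else if t ≤ 2 * N then 2 else
      if t ≤ 3 * N then 3 else 4) (by omega) (fun t _ _ => by grind) (by grind)
  refine ⟨c, hstep, hper, fun A B h1 h2 h3 h4 h5 => ?_⟩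
  have hb : ∀ t, 0 ≤ t → t ≤ T → (t = 0 ∧ c t = 0) ∨ (0 < t ∧ t ≤ N ∧ c t = 1) ∨
      (N < t ∧ t ≤ 2 * N ∧ c t = 2) ∨ (2 * N < t ∧ t ≤ 3 * N ∧ c t = 3) ∨
      (3 * N < t ∧ c t = 4) := by
    intro t ht ht'
    rw [hval t ht ht']
    split_ifs <;> omega
  have hA := hper A
  have hB := hper B
  rcases le_total 0 B with hB0 | hB0
  · rcases hb (A + T) (by omega) (by omega) with h | h | h | h | h <;>
    rcases hb B (by omega) (by omega) with h' | h' | h' | h' | h' <;> omega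
  · rcases hb (A + T) (by omega) (by omega) with h | h | h | h | h <;>
    rcases hb (B + T) (by omega) (by omega) with h' | h' | h' | h' | h' <;> omega

/-- Counting function of the items `0, N, 2N, 3N, 4N` modulo `T`. -/
theorem exists_selection_five {N T : ℤ} (hN : 1 ≤ N) (hT : 4 * N < T) (hT' : T ≤ 5 * N) :
    ∃ c : ℤ → ℤ, (∀ t, c t ≤ c (t + 1) ∧ c (t + 1) ≤ c t + 1) ∧
      (∀ t, c (t + T) = c t + 5) ∧
      ∀ A B : ℤ, -T < A → A ≤ 0 → A + N ≤ B → B ≤ A + T → (A ≤ -N ∨ 5 * N - T + 1 ≤ B) →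
        1 ≤ c B - c A ∧ c B - c A ≤ B - A - N + 1 := by
  obtain ⟨c, hstep, hper, hval⟩ := exists_periodic_extension (T := T) (m := 5)
    (c₀ := fun t => if t ≤ 0 then 0 else if t ≤ N then 1 else if t ≤ 2 * N then 2 else
      if t ≤ 3 * N then 3 else if t ≤ 4 * N then 4 else 5) (by omega) (fun t _ _ => by grind)
    (by grind)
  refine ⟨c, hstep, hper, fun A B h1 h2 h3 h4 h5 => ?_⟩
  have hb : ∀ t, 0 ≤ t → t ≤ T → (t = 0 ∧ c t = 0) ∨ (0 < t ∧ t ≤ N ∧ c t = 1) ∨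
      (N < t ∧ t ≤ 2 * N ∧ c t = 2) ∨ (2 * N < t ∧ t ≤ 3 * N ∧ c t = 3) ∨
      (3 * N < t ∧ t ≤ 4 * N ∧ c t = 4) ∨ (4 * N < t ∧ c t = 5) := by
    intro t ht ht'
    rw [hval t ht ht']
    split_ifs <;> omega
  have hA := hper A
  have hB := hper B
  rcases le_total 0 B with hB0 | hB0
  · rcases hb (A + T) (by omega) (by omega) with h | h | h | h | h | h <;>
    rcases hb B (by omega) (by omega) with h' | h' | h' | h' | h' | h' <;> omega
  · rcases hb (A + T) (by omega) (by omega) with h | h | h | h | h | h <;>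
    rcases hb (B + T) (by omega) (by omega) with h' | h' | h' | h' | h' | h' <;> omega

/-- Counting function of all the items other than `-1` modulo `T`. -/
theorem exists_selection_drop {T : ℤ} (hT : 2 ≤ T) :
    ∃ c : ℤ → ℤ, (∀ t, c t ≤ c (t + 1) ∧ c (t + 1) ≤ c t + 1) ∧
      (∀ t, c (t + T) = c t + (T - 1)) ∧
      ∀ A B : ℤ, -T < A → A ≤ 0 → A + 1 ≤ B → B ≤ A + T → (A ≤ -2 ∨ 1 ≤ B) →
        1 ≤ c B - c A := by
  obtain ⟨c, hstep, hper, hval⟩ := exists_periodic_extension (T := T) (m := T - 1)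
    (c₀ := fun t => min t (T - 1)) (by omega) (fun t _ _ => by omega) (by omega)
  refine ⟨c, hstep, hper, fun A B h1 h2 h3 h4 h5 => ?_⟩
  have hA := hper A
  have hB := hper B
  have hA' := hval (A + T) (by omega) (by omega)
  rcases le_total 0 B with hB0 | hB0
  · have := hval B (by omega) (by omega)
    beta_reduce at this hA'
    omega
  · have := hval (B + T) (by omega) (by omega)
    beta_reduce at this hA'
    omega

/-- If every window carries weight at least `N` and the total weight is between `4N` and `5N`,
then a cover can be split off so that the rest satisfies the same conditions for `N - 1`. -/
theorem exists_split {k : ℕ} [NeZero (3 * k)] {w : ZMod (3 * k) → ℤ} (hw : ∀ i, 0 ≤ w i)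
    {N : ℤ} (hN : 1 ≤ N) (hwin : ∀ i, N ≤ ∑ l ∈ Cseg (3 * k) k i, w l)
    (h4 : 4 * N ≤ ∑ l, w l) (h5 : ∑ l, w l ≤ 5 * N) :
    ∃ u : ZMod (3 * k) → ℤ, (∀ i, 0 ≤ u i) ∧ (∀ i, u i ≤ w i) ∧
      (∀ i, 1 ≤ ∑ l ∈ Cseg (3 * k) k i, u l ∧
        ∑ l ∈ Cseg (3 * k) k i, u l ≤ ∑ l ∈ Cseg (3 * k) k i, w l - N + 1) ∧
      4 * (N - 1) ≤ ∑ l, w l - ∑ l, u l ∧ ∑ l, w l - ∑ l, u l ≤ 5 * (N - 1) := by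
  have hk : k ≤ 3 * k := by omega
  have hT0 : 0 < ∑ l, w l := by omega
  obtain ⟨W, hW⟩ := exists_isPrimitive w
  have key : ∀ {τ : ℤ} {c : ℤ → ℤ} {m : ℤ}, (∀ t, c t ≤ c (t + 1) ∧ c (t + 1) ≤ c t + 1) →
      (∀ t, c (t + ∑ l, w l) = c t + m) →
      4 * (N - 1) ≤ ∑ l, w l - m → ∑ l, w l - m ≤ 5 * (N - 1) →
      (∀ p : ℤ, -(∑ l, w l) < W p - τ → W p - τ ≤ 0 → W p - τ + N ≤ W (p + k) - τ →
        W (p + k) - τ ≤ W p - τ + ∑ l, w l →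
        1 ≤ c (W (p + k) - τ) - c (W p - τ) ∧
        c (W (p + k) - τ) - c (W p - τ) ≤ W (p + k) - τ - (W p - τ) - N + 1) →
      ∃ u : ZMod (3 * k) → ℤ, (∀ i, 0 ≤ u i) ∧ (∀ i, u i ≤ w i) ∧
        (∀ i, 1 ≤ ∑ l ∈ Cseg (3 * k) k i, u l ∧
          ∑ l ∈ Cseg (3 * k) k i, u l ≤ ∑ l ∈ Cseg (3 * k) k i, w l - N + 1) ∧
        4 * (N - 1) ≤ ∑ l, w l - ∑ l, u l ∧ ∑ l, w l - ∑ l, u l ≤ 5 * (N - 1) := by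
    intro τ c m hc hper hm4 hm5 hcw
    obtain ⟨u, hu0, huw, hum, hu⟩ := (hW.sub_const τ).exists_selection hw hc hper
    refine ⟨u, hu0, huw, fun i => ?_, by rw [hum]; exact hm4, by rw [hum]; exact hm5⟩
    obtain ⟨p, rfl, hp, hp'⟩ := (hW.sub_const τ).exists_lift hT0 i
    have hwp := hwin p
    rw [hu.sum_Cseg hk]
    rw [hW.sum_Cseg hk] at hwp ⊢
    have hle := hW.monotone hw (show p + k ≤ p + (3 * k : ℕ) by push_cast; omega)
    rw [hW.add_period] at hle
    have := hcw p hp hp' (by linarith) (by linarith)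
    simp only [Function.comp_apply]
    constructor <;> linarith [this.1, this.2]
  rcases le_total (2 * ∑ l, w l) (9 * N) with h | h
  · obtain ⟨p, hp⟩ := hW.exists_heavy hw hT0 (M := ∑ l, w l - 3 * N) (by omega)
    obtain ⟨c, hc, hper, hcw⟩ := exists_selection_four hN h4
    refine key (τ := W (p + k + 1) - 1) hc hper (by omega) (by omega)
      fun q h1 h2 h3 h4 => hcw _ _ h1 h2 h3 h4 fun h6 => ?_
    rcases le_or_gt q p with hq | hq
    · have := hW.monotone hw hq
      omega
    · have := hW.monotone hw (show p + k + 1 ≤ q + k by omega)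
      omega
  · obtain ⟨p, hp⟩ := hW.exists_heavy hw hT0 (M := 6 * N - ∑ l, w l) (by omega)
    obtain ⟨c, hc, hper, hcw⟩ := exists_selection_five hN (by omega) h5
    refine key (τ := W p + N) hc hper (by omega) (by omega)
      fun q h1 h2 h3 h4 => hcw _ _ h1 h2 h3 h4 ?_
    rcases le_or_gt q p with hq | hq
    · have := hW.monotone hw hq
      omega
    · have := hW.monotone hw (show p + k + 1 ≤ q + k by omega)
      omega

/-- A valid inequality with nonnegative coefficients, evaluated at an integer vector meeting every
window. -/
theorem IsValid.le_sum_mul {n k : ℕ} [NeZero n] {a : ZMod n → ℤ} {α : ℤ} (h : IsValid n k a α)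
    (ha : ∀ i, 0 ≤ a i) {u : ZMod n → ℤ} (hu : ∀ i, 0 ≤ u i)
    (hwin : ∀ i, 1 ≤ ∑ l ∈ Cseg n k i, u l) : α ≤ ∑ l, a l * u l := by
  have hcov : IsCover n k (Finset.univ.filter fun i => 0 < u i) := by
    intro i
    by_contra hi
    have := hwin i
    rw [Finset.sum_eq_zero fun l hl => ?_] at this
    · omega
    · by_contra hne
      exact hi ⟨l, by simp [hl, lt_of_le_of_ne (hu l) (Ne.symm hne)]⟩
  refine (h _ hcov).trans ?_
  rw [Finset.sum_filter]
  refine Finset.sum_le_sum fun i _ => ?_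
  split_ifs with h0
  · nlinarith [ha i]
  · exact mul_nonneg (ha i) (hu i)

/-- The points of total weight between `4` and `5` of the linear relaxation satisfy every valid
inequality. -/
theorem IsValid.mul_le_sum_mul {k : ℕ} [NeZero (3 * k)] {a : ZMod (3 * k) → ℤ} {α : ℤ}
    (h : IsValid (3 * k) k a α) (ha : ∀ i, 0 ≤ a i) (N : ℕ) {w : ZMod (3 * k) → ℤ}
    (hw : ∀ i, 0 ≤ w i) (hwin : ∀ i, (N : ℤ) ≤ ∑ l ∈ Cseg (3 * k) k i, w l)
    (h4 : 4 * (N : ℤ) ≤ ∑ l, w l) (h5 : ∑ l, w l ≤ 5 * N) : N * α ≤ ∑ l, a l * w l := by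
  induction N generalizing w with
  | zero => simpa using Finset.sum_nonneg fun i _ => mul_nonneg (ha i) (hw i)
  | succ N ih =>
    obtain ⟨u, hu0, huw, huwin, hu4, hu5⟩ := exists_split hw (by omega) hwin h4 h5
    have h1 := h.le_sum_mul ha hu0 fun i => (huwin i).1
    have h2 := ih (w := fun i => w i - u i) (fun i => sub_nonneg.2 (huw i))
      (fun i => by have := (huwin i).2; rw [Finset.sum_sub_distrib]; push_cast at this; linarith)
      (by rw [Finset.sum_sub_distrib]; push_cast at hu4; linarith)
      (by rw [Finset.sum_sub_distrib]; push_cast at hu5; linarith)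
    simp only [mul_sub, Finset.sum_sub_distrib] at h2
    push_cast
    linarith

/-- A linear form that is constant on the roots of a facet is a multiple of the facet; in
particular it vanishes as soon as it has a zero coefficient where the facet has none. -/
theorem IsFacet.eq_zero_of_const_on_roots {n k : ℕ} [NeZero n] {a : ZMod n → ℤ} {α : ℤ}
    (h : IsFacet n k a α) {b : ZMod n → ℤ} {β : ℤ}
    (hb : ∀ x, IsRoot n k a α x → ∑ i ∈ x, b i = β) {j : ZMod n} (haj : a j ≠ 0) (hbj : b j = 0)
    (i : ZMod n) : b i = 0 := by
  set S : Set (ZMod n → ℝ) :=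
    {v | ∃ x : Finset (ZMod n), IsRoot n k a α x ∧ v = charVec n x} with hS
  let L : (ZMod n → ℤ) → (ZMod n → ℝ) →ₗ[ℝ] ℝ := fun c =>
    ∑ i, (c i : ℝ) • LinearMap.proj (R := ℝ) (φ := fun _ : ZMod n => ℝ) i
  have hL : ∀ c v, L c v = ∑ i, (c i : ℝ) * v i := fun c v => by simp [L]
  have hchar : ∀ c x, L c (charVec n x) = ((∑ i ∈ x, c i : ℤ) : ℝ) := fun c x => by
    rw [hL]; simp [charVec]
  have hker : ∀ c γ, (∀ x, IsRoot n k a α x → ∑ i ∈ x, c i = γ) →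
      (affineSpan ℝ S).direction ≤ LinearMap.ker (L c) := by
    intro c γ hc
    rw [direction_affineSpan, vectorSpan_def, Submodule.span_le]
    rintro _ ⟨_, ⟨x, hx, rfl⟩, _, ⟨y, hy, rfl⟩, rfl⟩
    simp only [SetLike.mem_coe, LinearMap.mem_ker, vsub_eq_sub, map_sub, hchar, hc x hx, hc y hy,
      sub_self]
  have hsingle : ∀ c l, L c (Pi.single l 1) = c l := fun c l => by simp [hL, Pi.single_apply]
  have ha0 : L a ≠ 0 := fun h0 => haj (by simpa [h0] using (hsingle a j).symm)
  have hdim := Module.Dual.finrank_ker_add_one_of_ne_zero ha0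
  rw [Module.finrank_fintype_fun_eq_card, ZMod.card] at hdim
  have heq : (affineSpan ℝ S).direction = LinearMap.ker (L a) :=
    Submodule.eq_of_le_of_finrank_eq (hker a α fun x hx => hx.2) (by
      rw [h.2]; omega)
  have hle := hker b β hb
  rw [heq] at hle
  have hmem : (a j : ℝ) • Pi.single i (1 : ℝ) - (a i : ℝ) • Pi.single j (1 : ℝ)
      ∈ LinearMap.ker (L a) := by
    rw [LinearMap.mem_ker, map_sub, map_smul, map_smul, hsingle, hsingle, smul_eq_mul, smul_eq_mul]
    ring
  have hz := hle hmem
  rw [LinearMap.mem_ker, map_sub, map_smul, map_smul, hsingle, hsingle, hbj] at hz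
  simpa [haj] using hz

/-- The characteristic function of a subset of `ℤ_n`, with integer values. -/
def indicatorInt {n : ℕ} (x : Finset (ZMod n)) (i : ZMod n) : ℤ := if i ∈ x then 1 else 0

theorem sum_indicatorInt {n : ℕ} (x s : Finset (ZMod n)) :
    ∑ l ∈ s, indicatorInt x l = (x ∩ s).card := by
  simp [indicatorInt, Finset.inter_comm]

theorem sum_univ_indicatorInt {n : ℕ} [NeZero n] (x : Finset (ZMod n)) :
    ∑ l, indicatorInt x l = x.card := by
  rw [sum_indicatorInt, Finset.inter_univ]

theorem sum_mul_indicatorInt {n : ℕ} [NeZero n] (a : ZMod n → ℤ) (x : Finset (ZMod n)) :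
    ∑ l, a l * indicatorInt x l = ∑ l ∈ x, a l := by
  simp [indicatorInt]

theorem indicatorInt_nonneg {n : ℕ} (x : Finset (ZMod n)) (i : ZMod n) : 0 ≤ indicatorInt x i := by
  unfold indicatorInt; split_ifs <;> decide

theorem IsCover.one_le_sum {n k : ℕ} {x : Finset (ZMod n)} (hx : IsCover n k x) (i : ZMod n) :
    1 ≤ ∑ l ∈ Cseg n k i, indicatorInt x l := by
  rw [sum_indicatorInt]
  exact_mod_cast (hx i).card_pos

/-- The three windows `C^i`, `C^{i+k}`, `C^{i+2k}` partition `ℤ_{3k}`. -/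
theorem sum_univ_eq_sum_Cseg {k : ℕ} [NeZero (3 * k)] (w : ZMod (3 * k) → ℤ) (i : ZMod (3 * k)) :
    ∑ l, w l = ∑ l ∈ Cseg (3 * k) k i, w l + ∑ l ∈ Cseg (3 * k) k (i + k), w l
      + ∑ l ∈ Cseg (3 * k) k (i + k + k), w l := by
  obtain ⟨W, hW⟩ := exists_isPrimitive w
  have h1 := hW.sum_Cseg (k := k) (by omega) i.val
  have h2 := hW.sum_Cseg (k := k) (by omega) (i.val + k)
  have h3 := hW.sum_Cseg (k := k) (by omega) (i.val + k + k)
  have h4 := hW.add_period i.val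
  rw [show (i.val : ℤ) + (3 * k : ℕ) = i.val + k + k + k by push_cast; ring] at h4
  push_cast at h1 h2 h3
  rw [ZMod.natCast_zmod_val] at h1 h2 h3
  rw [h1, h2, h3]
  linarith

theorem IsCover.three_le_card {k : ℕ} [NeZero (3 * k)] {x : Finset (ZMod (3 * k))}
    (hx : IsCover (3 * k) k x) : 3 ≤ x.card := by
  have h := sum_univ_eq_sum_Cseg (indicatorInt x) 0
  rw [sum_univ_indicatorInt] at h
  have h1 := hx.one_le_sum 0
  have h2 := hx.one_le_sum (0 + k)
  have h3 := hx.one_le_sum (0 + k + k)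
  omega

theorem IsCover.sum_eq_one {k : ℕ} [NeZero (3 * k)] {x : Finset (ZMod (3 * k))}
    (hx : IsCover (3 * k) k x) (hc : x.card = 3) (i : ZMod (3 * k)) :
    ∑ l ∈ Cseg (3 * k) k i, indicatorInt x l = 1 := by
  have h := sum_univ_eq_sum_Cseg (indicatorInt x) i
  rw [sum_univ_indicatorInt] at h
  have h1 := hx.one_le_sum i
  have h2 := hx.one_le_sum (i + k)
  have h3 := hx.one_le_sum (i + k + k)
  omega

theorem IsCover.add_mem_iff {k : ℕ} [NeZero (3 * k)] {x : Finset (ZMod (3 * k))}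
    (hx : IsCover (3 * k) k x) (hc : x.card = 3) (i : ZMod (3 * k)) :
    i + k ∈ x ↔ i ∈ x := by
  obtain ⟨W, hW⟩ := exists_isPrimitive (indicatorInt x)
  have h1 := hx.sum_eq_one hc (i.val : ℤ)
  have h2 := hx.sum_eq_one hc ((i.val + 1 : ℤ) : ZMod (3 * k))
  have h3 := hW i.val
  have h4 := hW (i.val + k)
  rw [hW.sum_Cseg (by omega)] at h1 h2
  rw [add_right_comm] at h2
  have h5 : indicatorInt x (i + k) = indicatorInt x i := by
    push_cast at h3 h4
    rw [ZMod.natCast_zmod_val] at h3 h4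
    linarith
  unfold indicatorInt at h5
  split_ifs at h5 <;> simp_all

theorem mem_xcov {k : ℕ} (hk : 1 ≤ k) {i j : ZMod (3 * k)} :
    i ∈ xcov (3 * k) k j ↔ i = j ∨ i = j + k ∨ i = j + k + k := by
  have h3 : (3 * k + k - 1) / k = 3 := by
    rw [Nat.div_eq_iff (by omega)]; omega
  simp only [xcov, h3, Finset.mem_image, Finset.mem_range]
  constructor
  · rintro ⟨h, hh, rfl⟩
    interval_cases h
    · simp
    · simp
    · right; right; push_cast; ring
  · rintro (rfl | rfl | rfl)
    · exact ⟨0, by simp⟩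
    · exact ⟨1, by simp⟩
    · exact ⟨2, by omega, by push_cast; ring⟩

theorem card_xcov {k : ℕ} (hk : 1 ≤ k) (j : ZMod (3 * k)) : (xcov (3 * k) k j).card = 3 := by
  have h3 : (3 * k + k - 1) / k = 3 := by
    rw [Nat.div_eq_iff (by omega)]; omega
  rw [xcov, h3, Finset.card_image_of_injOn, Finset.card_range]
  intro x hx y hy hxy
  simp only [Finset.coe_range, Set.mem_Iio] at hx hy
  have h := (ZMod.natCast_eq_natCast_iff' _ _ _).1 (add_left_cancel hxy)
  rw [Nat.mod_eq_of_lt (by nlinarith), Nat.mod_eq_of_lt (by nlinarith)] at h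
  exact Nat.eq_of_mul_eq_mul_right hk h

theorem add_three_period {k : ℕ} (j : ZMod (3 * k)) : j + k + k + k = j := by
  have := ZMod.natCast_self (3 * k)
  push_cast at this
  linear_combination this

theorem isCover_xcov {k : ℕ} [NeZero (3 * k)] (hk : 1 ≤ k) (j : ZMod (3 * k)) :
    IsCover (3 * k) k (xcov (3 * k) k j) := by
  intro i
  obtain ⟨q, hq, rfl⟩ : ∃ q : ℕ, q < 3 * k ∧ j = i + q :=
    ⟨(j - i).val, ZMod.val_lt _, by simp⟩
  have hmod : ((q % k : ℕ) : ZMod (3 * k)) + (q / k : ℕ) * k = q := by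
    have := Nat.mod_add_div' q k
    exact_mod_cast congrArg (Nat.cast : ℕ → ZMod (3 * k)) this
  refine ⟨i + (q % k : ℕ), Finset.mem_inter.2 ⟨(mem_xcov hk).2 ?_,
    Finset.mem_image.2 ⟨q % k, Finset.mem_range.2 (Nat.mod_lt _ hk), rfl⟩⟩⟩
  have hdiv : q / k < 3 := (Nat.div_lt_iff_lt_mul hk).2 hq
  interval_cases hd : q / k
  · left; linear_combination hmod
  · right; right; push_cast at hmod; linear_combination hmod - add_three_period i
  · right; left; push_cast at hmod; linear_combination hmod - add_three_period i

/-- Two members of `x^j` belong to the same covers of size three. -/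
theorem IsCover.mem_iff_of_mem_xcov {k : ℕ} [NeZero (3 * k)] (hk : 1 ≤ k)
    {x : Finset (ZMod (3 * k))} (hx : IsCover (3 * k) k x) (hc : x.card = 3)
    {i j : ZMod (3 * k)} (hi : i ∈ xcov (3 * k) k j) : i ∈ x ↔ j ∈ x := by
  have h1 := hx.add_mem_iff hc j
  have h2 := hx.add_mem_iff hc (j + k)
  rcases (mem_xcov hk).1 hi with rfl | rfl | rfl <;> simp_all

theorem IsCover.eq_xcov {k : ℕ} [NeZero (3 * k)] (hk : 1 ≤ k)
    {x : Finset (ZMod (3 * k))} (hx : IsCover (3 * k) k x) (hc : x.card = 3)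
    {j : ZMod (3 * k)} (hj : j ∈ x) : x = xcov (3 * k) k j :=
  (Finset.eq_of_subset_of_card_le (fun i hi => (hx.mem_iff_of_mem_xcov hk hc hi).2 hj)
    (by rw [hc, card_xcov hk])).symm

/-- The roots of an inequality with positive coefficients have at most five elements. -/
theorem IsValid.card_root_le {k : ℕ} [NeZero (3 * k)] {a : ZMod (3 * k) → ℤ} {α : ℤ}
    (h : IsValid (3 * k) k a α) (ha : ∀ i, 1 ≤ a i) {x : Finset (ZMod (3 * k))}
    (hx : IsRoot (3 * k) k a α x) : x.card ≤ 5 := by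
  by_contra! hcard
  have hk : k ≤ 3 * k := by omega
  have hsum := sum_univ_indicatorInt x
  have hT0 : 0 < ∑ l, indicatorInt x l := by omega
  have hw := indicatorInt_nonneg x
  obtain ⟨W, hW⟩ := exists_isPrimitive (indicatorInt x)
  obtain ⟨p, hp⟩ := hW.exists_heavy hw hT0 (M := 2) (by omega)
  obtain ⟨c, hc, hper, hcw⟩ := exists_selection_drop (T := ∑ l, indicatorInt x l) (by omega)
  obtain ⟨u, hu0, huw, hum, hu⟩ := (hW.sub_const (W p + 2)).exists_selection hw hc hper
  have hval := h.le_sum_mul (fun i => (by linarith [ha i])) hu0 fun i => by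
    obtain ⟨q, rfl, hq, hq'⟩ := (hW.sub_const (W p + 2)).exists_lift hT0 i
    have hone := hx.1.one_le_sum q
    rw [hW.sum_Cseg hk] at hone
    rw [hu.sum_Cseg hk]
    have hle := hW.monotone hw (show q + k ≤ q + (3 * k : ℕ) by push_cast; omega)
    rw [hW.add_period] at hle
    refine hcw (W q - (W p + 2)) (W (q + k) - (W p + 2)) hq hq' (by omega) (by omega) ?_
    rcases le_or_gt q p with hqp | hqp
    · have := hW.monotone hw hqp
      omega
    · have := hW.monotone hw (show p + k + 1 ≤ q + k by omega)
      omega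
  have hroot := hx.2
  rw [← sum_mul_indicatorInt] at hroot
  have hdiff : ∑ l, (indicatorInt x l - u l) ≤ ∑ l, a l * (indicatorInt x l - u l) :=
    Finset.sum_le_sum fun i _ => by nlinarith [ha i, huw i]
  simp only [mul_sub, Finset.sum_sub_distrib] at hdiff
  omega

/-- Exchange argument: if no window is tight for all the roots, then taking `u` away from a root
and adding `g` instead does not decrease the weight, provided that the number of elements stays in
the right range. -/
theorem IsValid.le_of_exchange {k : ℕ} [NeZero (3 * k)] {a : ZMod (3 * k) → ℤ} {α : ℤ}
    (h : IsValid (3 * k) k a α) (ha : ∀ i, 0 ≤ a i)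
    {R : ZMod (3 * k) → Finset (ZMod (3 * k))} (hR : ∀ i, IsRoot (3 * k) k a α (R i))
    (hR2 : ∀ i, 2 ≤ ∑ l ∈ Cseg (3 * k) k i, indicatorInt (R i) l)
    {x : Finset (ZMod (3 * k))} (hx : IsRoot (3 * k) k a α x) {u : ZMod (3 * k)} (hu : u ∈ x)
    {M : ℕ} (hM : 1 ≤ M) {g : ZMod (3 * k) → ℤ} (hg : ∀ i, 0 ≤ g i)
    (h4 : 4 * ((3 * k + M : ℕ) : ℤ) ≤ ∑ i, ((R i).card : ℤ) + M * x.card - 1 + ∑ i, g i)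
    (h5 : ∑ i, ((R i).card : ℤ) + M * x.card - 1 + ∑ i, g i ≤ 5 * ((3 * k + M : ℕ) : ℤ)) :
    a u ≤ ∑ i, a i * g i := by
  let w : ZMod (3 * k) → ℤ := fun l =>
    ∑ i, indicatorInt (R i) l + M * indicatorInt x l - indicatorInt {u} l + g l
  have hsum : ∀ s : Finset (ZMod (3 * k)), ∑ l ∈ s, w l =
      ∑ i, ∑ l ∈ s, indicatorInt (R i) l + M * ∑ l ∈ s, indicatorInt x l
        - ∑ l ∈ s, indicatorInt {u} l + ∑ l ∈ s, g l := by
    intro s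
    simp only [w, Finset.sum_add_distrib, Finset.sum_sub_distrib, Finset.mul_sum]
    rw [Finset.sum_comm]
  have htot : ∑ l, w l = ∑ i, ((R i).card : ℤ) + M * x.card - 1 + ∑ i, g i := by
    rw [hsum]
    simp only [sum_univ_indicatorInt, Finset.card_singleton, Nat.cast_one]
  have hw : ∀ l, 0 ≤ w l := by
    intro l
    have h1 : 0 ≤ ∑ i, indicatorInt (R i) l :=
      Finset.sum_nonneg fun i _ => indicatorInt_nonneg _ _
    have h2 : indicatorInt {u} l ≤ M * indicatorInt x l := by
      by_cases hl : l = u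
      · subst hl
        simp [indicatorInt, hu]; omega
      · simp only [indicatorInt, Finset.mem_singleton, hl, if_false]
        split_ifs <;> simp
    have := hg l
    simp only [w]
    linarith
  have hwin : ∀ j, ((3 * k + M : ℕ) : ℤ) ≤ ∑ l ∈ Cseg (3 * k) k j, w l := by
    intro j
    have h1 : ((3 * k : ℕ) : ℤ) + 1 ≤ ∑ i, ∑ l ∈ Cseg (3 * k) k j, indicatorInt (R i) l := by
      have : ∑ i : ZMod (3 * k), (1 + if i = j then 1 else 0 : ℤ) ≤
          ∑ i, ∑ l ∈ Cseg (3 * k) k j, indicatorInt (R i) l := by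
        refine Finset.sum_le_sum fun i _ => ?_
        split_ifs with hij
        · subst hij; exact hR2 i
        · simpa using (hR i).1.one_le_sum j
      rw [Finset.sum_add_distrib] at this
      simpa [ZMod.card] using this
    have h2 : ∑ l ∈ Cseg (3 * k) k j, indicatorInt {u} l ≤ 1 := by
      rw [sum_indicatorInt]
      exact_mod_cast (Finset.card_le_card Finset.inter_subset_left).trans_eq
        (Finset.card_singleton u)
    have h3 := mul_le_mul_of_nonneg_left (hx.1.one_le_sum j) (Int.natCast_nonneg M)
    have h6 : 0 ≤ ∑ l ∈ Cseg (3 * k) k j, g l := Finset.sum_nonneg fun i _ => hg i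
    rw [hsum]
    push_cast at h1 ⊢
    linarith
  have key := h.mul_le_sum_mul ha (3 * k + M) hw hwin (by rwa [htot]) (by rwa [htot])
  have hval : ∑ l, a l * w l = ((3 * k + M : ℕ) : ℤ) * α - a u + ∑ i, a i * g i := by
    have e : ∀ l, a l * w l = ∑ i, a l * indicatorInt (R i) l + M * (a l * indicatorInt x l)
        - a l * indicatorInt {u} l + a l * g l := by
      intro l
      simp only [w, ← Finset.mul_sum]
      ring
    simp only [e, Finset.sum_add_distrib, Finset.sum_sub_distrib]
    rw [Finset.sum_comm, ← Finset.mul_sum]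
    simp only [sum_mul_indicatorInt, (hR _).2, hx.2, Finset.sum_const, Finset.card_univ, ZMod.card,
      Finset.sum_singleton, nsmul_eq_mul]
    push_cast
    ring
  linarith

theorem stmt19 (k : ℕ) (hk : 3 ≤ k)
    (a : ZMod (3 * k) → ℤ) (α : ℤ) (hpos : ∀ i : ZMod (3 * k), 1 ≤ a i)
    (hfacet : IsFacet (3 * k) k a α)
    (hnonbool : ¬ IsBooleanMultiple (3 * k) k a α) :
    ∃ a0 : ℤ, 1 ≤ a0 ∧ ∃ W : Finset (ZMod (3 * k)),
      (∀ j : ZMod (3 * k), (W ∩ xcov (3 * k) k j).card = 1) ∧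
      (∀ j : ZMod (3 * k), 2 ≤ ((Cseg (3 * k) k j).filter (fun l => l ∉ W)).card) ∧
      (∀ i : ZMod (3 * k), a i = if i ∈ W then 2 * a0 else a0) ∧
      α = 4 * a0 := by
  classical
  have : NeZero (3 * k) := ⟨by omega⟩
  have hk1 : 1 ≤ k := by omega
  have hvalid := hfacet.1
  have ha0 : ∀ i, 0 ≤ a i := fun i => by linarith [hpos i]
  have hane : ∀ i, a i ≠ 0 := fun i => by have := hpos i; omega
  have hroot : ∀ i, ∃ x, IsRoot (3 * k) k a α x ∧
      2 ≤ ∑ l ∈ Cseg (3 * k) k i, indicatorInt x l := by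
    intro i
    by_contra! hne
    obtain ⟨j, -, hj⟩ : ∃ j ∈ Finset.univ, j ∉ Cseg (3 * k) k i :=
      Finset.exists_mem_notMem_of_card_lt_card (by
        rw [card_Cseg (by omega), Finset.card_univ, ZMod.card]; omega)
    have h0 := hfacet.eq_zero_of_const_on_roots (b := indicatorInt (Cseg (3 * k) k i)) (β := 1)
      (fun x hx => by
        have h1 := hne x hx
        have h2 := hx.1.one_le_sum i
        rw [sum_indicatorInt] at h1 h2 ⊢
        rw [Finset.inter_comm]; omega) (hane j) (if_neg hj) i
    have hi : i ∈ Cseg (3 * k) k i :=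
      Finset.mem_image.2 ⟨0, Finset.mem_range.2 (by omega), by simp⟩
    simp [indicatorInt, hi] at h0
  choose R hR hR2 using hroot
  have hcard3 : ∑ i : ZMod (3 * k), (3 : ℤ) ≤ ∑ i, ((R i).card : ℤ) :=
    Finset.sum_le_sum fun i _ => by exact_mod_cast (hR i).1.three_le_card
  have hcard5 : ∑ i, ((R i).card : ℤ) ≤ ∑ i : ZMod (3 * k), (5 : ℤ) :=
    Finset.sum_le_sum fun i _ => by exact_mod_cast hvalid.card_root_le hpos (hR i)
  simp only [Finset.sum_const, Finset.card_univ, ZMod.card, nsmul_eq_mul] at hcard3 hcard5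
  have hle4 : ∀ x, IsRoot (3 * k) k a α x → x.card = 3 ∨ x.card = 4 := by
    intro x hx
    have h3 := hx.1.three_le_card
    have h5 := hvalid.card_root_le hpos hx
    by_contra hne
    have hx5 : x.card = 5 := by omega
    obtain ⟨u, hu⟩ := Finset.card_pos.1 (show 0 < x.card by omega)
    have := hvalid.le_of_exchange ha0 hR hR2 hx hu (M := 3 * k + 1) (by omega) (g := fun _ => 0)
      (fun _ => le_rfl) (by simp [hx5] at *; linarith) (by simp [hx5] at *; linarith)
    simp only [mul_zero, Finset.sum_const_zero] at this
    linarith [hpos u]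
  have hR4 : ∀ i, (R i).card = 4 := fun i => (hle4 _ (hR i)).resolve_left fun h3 => by
    have := (hR i).1.sum_eq_one h3 i
    have := hR2 i
    omega
  have hmin : ∀ x, IsRoot (3 * k) k a α x → x.card = 4 → ∀ u ∈ x, ∀ v, a u ≤ a v := by
    intro x hx hx4 u hu v
    have h1 : ∑ i, indicatorInt {v} i = 1 := by
      rw [sum_univ_indicatorInt, Finset.card_singleton, Nat.cast_one]
    have := hvalid.le_of_exchange ha0 hR hR2 hx hu (M := 1) le_rfl (g := indicatorInt {v})
      (indicatorInt_nonneg _)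
      (by simp only [h1, hx4, hR4, Finset.sum_const, Finset.card_univ, ZMod.card, nsmul_eq_mul]
          push_cast; linarith)
      (by simp only [h1, hx4, hR4, Finset.sum_const, Finset.card_univ, ZMod.card, nsmul_eq_mul]
          push_cast; linarith)
    rwa [sum_mul_indicatorInt, Finset.sum_singleton] at this
  obtain ⟨u₀, hu₀⟩ := Finset.card_pos.1 (show 0 < (R 0).card by rw [hR4]; omega)
  have hmem : ∀ x, IsRoot (3 * k) k a α x → x.card = 4 → ∀ u ∈ x, a u = a u₀ :=
    fun x hx hx4 u hu =>
      le_antisymm (hmin x hx hx4 u hu u₀) (hmin _ (hR 0) (hR4 0) u₀ hu₀ u)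
  have hα : α = 4 * a u₀ := by
    rw [← (hR 0).2, Finset.sum_congr rfl (hmem _ (hR 0) (hR4 0)), Finset.sum_const, hR4]
    simp
  let W : Finset (ZMod (3 * k)) :=
    Finset.univ.filter fun i => ∀ x, IsRoot (3 * k) k a α x → x.card = 4 → i ∉ x
  have hW : ∀ i, i ∈ W ↔ ∀ x, IsRoot (3 * k) k a α x → x.card = 4 → i ∉ x := fun i => by simp [W]
  have haW : ∀ i, i ∉ W → a i = a u₀ := by
    intro i hi
    rw [hW] at hi
    push Not at hi
    obtain ⟨x, hx, hx4, hix⟩ := hi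
    exact hmem x hx hx4 i hix
  have hW1 : ∀ j, (W ∩ xcov (3 * k) k j).card = 1 := by
    intro j
    refine le_antisymm (Finset.card_le_one.2 fun i hi i' hi' => ?_) (Finset.card_pos.2 ?_)
    · rw [Finset.mem_inter] at hi hi'
      by_contra hne
      obtain ⟨l, -, hl⟩ : ∃ l ∈ Finset.univ, l ∉ ({i, i'} : Finset (ZMod (3 * k))) :=
        Finset.exists_mem_notMem_of_card_lt_card (by
          rw [Finset.card_univ, ZMod.card]
          exact Finset.card_le_two.trans_lt (by omega))
      simp only [Finset.mem_insert, Finset.mem_singleton, not_or] at hl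
      have h0 := hfacet.eq_zero_of_const_on_roots (β := 0)
        (b := fun m => indicatorInt {i} m - indicatorInt {i'} m)
        (fun x hx => by
          rw [Finset.sum_sub_distrib, sum_indicatorInt, sum_indicatorInt]
          have hiff : i ∈ x ↔ i' ∈ x := by
            rcases hle4 x hx with h | h
            · rw [hx.1.mem_iff_of_mem_xcov hk1 h hi.2, hx.1.mem_iff_of_mem_xcov hk1 h hi'.2]
            · exact iff_of_false ((hW i).1 hi.1 x hx h) ((hW i').1 hi'.1 x hx h)
          by_cases hix : i ∈ x
          · simp [Finset.singleton_inter_of_mem, hix, hiff.1 hix]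
          · simp [Finset.singleton_inter_of_notMem, hix, mt hiff.2 hix])
        (hane l) (by simp [indicatorInt, hl]) i
      simp [indicatorInt, hne] at h0
    · by_contra hemp
      have hsum := hvalid _ (isCover_xcov hk1 j)
      rw [Finset.sum_congr rfl fun i hi => haW i fun hiW =>
        hemp ⟨i, Finset.mem_inter.2 ⟨hiW, hi⟩⟩, Finset.sum_const, card_xcov hk1] at hsum
      have := hpos u₀
      simp at hsum
      omega
  refine ⟨a u₀, hpos u₀, W, hW1, fun j => ?_, fun i => ?_, hα⟩
  · have h2 := hR2 j
    rw [sum_indicatorInt] at h2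
    refine le_trans (by exact_mod_cast h2) (Finset.card_le_card fun l hl => ?_)
    rw [Finset.mem_inter] at hl
    exact Finset.mem_filter.2 ⟨hl.2, fun hlW => (hW l).1 hlW _ (hR j) (hR4 j) hl.1⟩
  · split_ifs with hi
    · have hex : ∃ x, IsRoot (3 * k) k a α x ∧ i ∈ x := by
        by_contra! hno
        have : Fact (1 < 3 * k) := ⟨by omega⟩
        have h0 := hfacet.eq_zero_of_const_on_roots (b := indicatorInt {i}) (β := 0)
          (fun x hx => by
            rw [sum_indicatorInt, Finset.singleton_inter_of_notMem (hno x hx)]; rfl)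
          (hane (i + 1)) (by simp [indicatorInt]) i
        simp [indicatorInt] at h0
      obtain ⟨x, hx, hix⟩ := hex
      have hx3 : x.card = 3 := (hle4 x hx).resolve_right fun h => (hW i).1 hi x hx h hix
      have hxe := hx.1.eq_xcov hk1 hx3 hix
      have hone := hW1 i
      rw [← hxe] at hone
      have hrest : ∀ l ∈ x.erase i, a l = a u₀ := fun l hl => haW l fun hlW =>
        (Finset.mem_erase.1 hl).1 (Finset.card_le_one.1 hone.le l
          (Finset.mem_inter.2 ⟨hlW, (Finset.mem_erase.1 hl).2⟩) i (Finset.mem_inter.2 ⟨hi, hix⟩))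
      have hsum := hx.2
      rw [← Finset.add_sum_erase x a hix, Finset.sum_congr rfl hrest, Finset.sum_const,
        Finset.card_erase_of_mem hix, hx3] at hsum
      simp at hsum
      omega
    · exact haW i hi
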